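/- Let ξ be a point process on ℝ^d, let B ⊂ ℝ^d and D ⊂ ℝ^d be compact, and let A ⊂ ℝ^d be a Borel set such that the map (z, μ) ↦ μ_{A_z} is product measurable. Let T : N → N be a measurable map with the localization property (T(μ))_B = (T(μ_{B+D}))_B for every μ ∈ N (this covers the paper's construction ζ = Σ_{𝐱 ∈ ξ^k_≠} h(𝐱, ξ_{D_{z(𝐱)}}) δ_{z(𝐱)} for translation-invariant h and a center function z), and set ζ := T(ξ); assume the intensity measure E[ζ] is locally finite. Let (ξ^{z,ζ})_{z ∈ ℝ^d} be a Palm version of ξ with respect to ζ, i.e. a probability kernel z ↦ law(ξ^{z,ζ}) from ℝ^d to N satisfying E[∫ f(z, ξ) ζ(dz)] = ∫ E[f(z, ξ^{z,ζ})] E[ζ](dz) for all measurable f : ℝ^d × N → [0,∞]. Let F : N → [0, ∞) be measurable, and assume (z, ω) ↦ F(ξ(ω)_{A_z}) is jointly measurable with measurable supremum over z ∈ B. Then for all p, q > 0 with 1/p + 1/q ≤ 1: |∫_B E[F((ξ^{z,ζ})_{A_z}) − F(ξ_{A_z})] E[ζ](dz)| ≤ 4 · (E[ζ(B)^p])^{1/p}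 · (E[(sup_{z ∈ B} F(ξ_{A_z}))^q])^{1/q} · (β^ξ_{B+D, B+A})^{1 − 1/p − 1/q}. -/

import Mathlib

open MeasureTheory ENNReal NNReal Pointwise

section SetsFromRestriction

variable {X Y : Type*} [MeasurableSpace X] [MeasurableSpace Y]

/-- A measurable subset of `X × Measure Y` only depends on the second variable through the
values of the measure on countably many measurable sets. -/
lemma exists_countable_determining {M : Set (X × Measure Y)} (hM : MeasurableSet M) :
    ∃ 𝒞 : Set (Set Y), 𝒞.Countable ∧ (∀ C ∈ 𝒞, MeasurableSet C) ∧
      ∀ x μ ν, (∀ C ∈ 𝒞, μ C = ν C) → ((x, μ) ∈ M ↔ (x, ν) ∈ M) := by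
  let m : MeasurableSpace (X × Measure Y) :=
    { MeasurableSet' := fun M => ∃ 𝒞 : Set (Set Y), 𝒞.Countable ∧ (∀ C ∈ 𝒞, MeasurableSet C) ∧
        ∀ x μ ν, (∀ C ∈ 𝒞, μ C = ν C) → ((x, μ) ∈ M ↔ (x, ν) ∈ M)
      measurableSet_empty := ⟨∅, by simp⟩
      measurableSet_compl := by
        rintro s ⟨𝒞, h1, h2, h3⟩
        exact ⟨𝒞, h1, h2, fun x μ ν h => not_congr (h3 x μ ν h)⟩
      measurableSet_iUnion := by
        intro s hs
        choose 𝒞 h1 h2 h3 using hs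
        refine ⟨⋃ i, 𝒞 i, Set.countable_iUnion h1, ?_, ?_⟩
        · intro C hC
          obtain ⟨i, hi⟩ := Set.mem_iUnion.1 hC
          exact h2 i C hi
        · intro x μ ν h
          simp only [Set.mem_iUnion]
          exact exists_congr fun i => h3 i x μ ν fun C hC => h C (Set.mem_iUnion.2 ⟨i, hC⟩) }
  have hle : (Prod.instMeasurableSpace : MeasurableSpace (X × Measure Y)) ≤ m := by
    refine sup_le ?_ ?_
    · rintro _ ⟨t, -, rfl⟩
      exact ⟨∅, by simp⟩
    · rw [Measure.instMeasurableSpace, MeasurableSpace.comap_iSup]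
      refine iSup_le fun s => ?_
      rw [MeasurableSpace.comap_iSup]
      refine iSup_le fun hs => ?_
      rintro _ ⟨_, ⟨t, -, rfl⟩, rfl⟩
      refine ⟨{s}, by simp, by simpa using hs, fun x μ ν h => ?_⟩
      simp [h s rfl]
  exact hle M hM

/-- Restricting measures to a measurable set is measurable. -/
lemma measurable_measure_restrict {S : Set Y} (hS : MeasurableSet S) :
    Measurable fun μ : Measure Y => μ.restrict S := by
  refine Measure.measurable_of_measurable_coe _ fun t ht => ?_
  simp only [Measure.restrict_apply ht]
  exact Measure.measurable_coe (ht.inter hS)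

/-- A set is measurable as soon as restricting measures to it is measurable. -/
lemma measurableSet_of_measurable_restrict [MeasurableSingletonClass Y] {S : Set Y}
    (hS : Measurable fun μ : Measure Y => μ.restrict S) : MeasurableSet S := by
  have h : Measurable fun y : Y => ((Measure.dirac y).restrict S) Set.univ :=
    (Measure.measurable_coe MeasurableSet.univ).comp (hS.comp Measure.measurable_dirac)
  have h' := h (measurableSet_singleton (1 : ℝ≥0∞))
  convert h' using 1
  ext y
  by_cases hy : y ∈ S <;> simp [hy]

/-- If restriction of measures to `S x` is jointly measurable over *all* measures, then arbitrary
unions of the sets `S x` are measurable: they are unions of subfamilies of a countable family. -/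
lemma measurableSet_biUnion_of_measurable_restrict [MeasurableSingletonClass Y] {S : X → Set Y}
    (hS : Measurable fun xμ : X × Measure Y => xμ.2.restrict (S xμ.1)) (I : Set X) :
    MeasurableSet (⋃ x ∈ I, S x) := by
  have hSm (x : X) : MeasurableSet (S x) :=
    measurableSet_of_measurable_restrict (hS.comp measurable_prodMk_left)
  obtain ⟨𝒞, hc, hm, hdet⟩ := exists_countable_determining
    (((Measure.measurable_coe MeasurableSet.univ).comp hS) (measurableSet_singleton (0 : ℝ≥0∞)))
  have key (x : X) (y : Y) (hy : y ∈ S x) : ∃ C ∈ 𝒞, C ⊆ S x ∧ y ∈ C := by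
    by_contra! hcon
    let μ : Measure Y := (⊤ : ℝ≥0∞) • Measure.count.restrict (S x)ᶜ
    have hμ : μ (S x) = 0 := by simp [μ, Measure.restrict_apply (hSm x)]
    have := (hdet x μ (μ + Measure.dirac y) ?_).1 (by simpa using hμ)
    · simp [hy] at this
    · intro C hC
      by_cases hyC : y ∈ C
      · have hCS : ¬ C ⊆ S x := fun h => hcon C hC h hyC
        have : μ C = ⊤ := by
          simp only [μ, Measure.smul_apply, smul_eq_mul, Measure.restrict_apply (hm C hC)]
          apply ENNReal.top_mul
          rw [Measure.count_ne_zero_iff]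
          obtain ⟨w, hw, hw'⟩ := Set.not_subset.1 hCS
          exact ⟨w, hw, hw'⟩
        simp [this]
      · simp [hyC]
  have heq : (⋃ x ∈ I, S x) = ⋃ C ∈ {C ∈ 𝒞 | ∃ x ∈ I, C ⊆ S x}, C := by
    apply Set.Subset.antisymm
    · refine Set.iUnion₂_subset fun x hx y hy => ?_
      obtain ⟨C, hC, hCS, hyC⟩ := key x y hy
      exact Set.mem_biUnion (show C ∈ {C ∈ 𝒞 | ∃ x ∈ I, C ⊆ S x} from ⟨hC, x, hx, hCS⟩) hyC
    · refine Set.iUnion₂_subset fun C hC => ?_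
      obtain ⟨-, x, hx, hCS⟩ := hC
      exact hCS.trans (Set.subset_biUnion_of_mem hx)
  rw [heq]
  exact MeasurableSet.biUnion (hc.mono fun C hC => hC.1) fun C hC => hm C hC.1

end SetsFromRestriction

section TotalVariation

variable {E : Type*} [MeasurableSpace E]

/-- The positive part of the difference of two finite measures. -/
lemma exists_le_and_le_add (J Q : Measure E) [IsFiniteMeasure J] [IsFiniteMeasure Q] :
    ∃ ρ : Measure E, ρ ≤ J ∧ J ≤ ρ + Q ∧
      ∃ s, MeasurableSet s ∧ ρ Set.univ = J s - Q s := by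
  obtain ⟨s, hs⟩ := exists_isHahnDecomposition Q J
  refine ⟨J.restrict s - Q.restrict s, Measure.sub_le.trans Measure.restrict_le_self, ?_, s,
    hs.measurableSet, ?_⟩
  · calc J = J.restrict s + J.restrict sᶜ := (Measure.restrict_add_restrict_compl hs.1).symm
      _ ≤ J.restrict s + Q.restrict sᶜ := add_le_add le_rfl hs.ge_on_compl
      _ = (J.restrict s - Q.restrict s) + (Q.restrict s + Q.restrict sᶜ) := by
        rw [← add_assoc, Measure.sub_add_cancel_of_le hs.le_on]
      _ = _ := by rw [Measure.restrict_add_restrict_compl hs.1]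
  · rw [Measure.sub_apply MeasurableSet.univ hs.le_on]
    simp

/-- Hölder's inequality with a weight bounded by one. -/
lemma lintegral_mul_mul_le_of_le_one {Ω : Type*} [MeasurableSpace Ω] {P : Measure Ω}
    {f g h : Ω → ℝ≥0∞} (hf : AEMeasurable f P) (hg : AEMeasurable g P) (hh : AEMeasurable h P)
    (h1 : ∀ᵐ ω ∂P, h ω ≤ 1) {p q : ℝ} (hp : 0 < p) (hq : 0 < q) (hpq : 1 / p + 1 / q ≤ 1) :
    ∫⁻ ω, f ω * g ω * h ω ∂P ≤ (∫⁻ ω, f ω ^ p ∂P) ^ (1 / p) * (∫⁻ ω, g ω ^ q ∂P) ^ (1 / q) *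
      (∫⁻ ω, h ω ∂P) ^ (1 - 1 / p - 1 / q) := by
  have hp' : 0 < 1 / p := by positivity
  have hq' : 0 < 1 / q := by positivity
  have hs : 1 - 1 / p - 1 / q ≤ 1 := by linarith
  have H := ENNReal.lintegral_prod_norm_pow_le (μ := P) (Finset.univ : Finset (Fin 3))
    (f := ![fun ω => f ω ^ p, fun ω => g ω ^ q, h])
    (p := ![1 / p, 1 / q, 1 - 1 / p - 1 / q])
    (by
      intro i _
      fin_cases i
      · exact hf.pow_const p
      · exact hg.pow_const q
      · exact hh)
    (by simp [Fin.sum_univ_three])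
    (by
      intro i _
      fin_cases i
      · exact hp'.le
      · exact hq'.le
      · change 0 ≤ 1 - 1 / p - 1 / q
        linarith)
  simp only [Fin.prod_univ_three, Matrix.cons_val_zero, Matrix.cons_val_one,
    Matrix.cons_val_two] at H
  refine le_trans (lintegral_mono_ae ?_) H
  filter_upwards [h1] with ω hω
  rw [← ENNReal.rpow_mul, ← ENNReal.rpow_mul, mul_one_div_cancel hp.ne', mul_one_div_cancel hq.ne',
    ENNReal.rpow_one, ENNReal.rpow_one]
  gcongr
  simpa using ENNReal.rpow_le_rpow_of_exponent_ge hω hs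

/-- The difference of the integrals of `Φ` against `P.map Z` and `Q`, when `Φ ∘ Z` is bounded by a
product, is controlled by moments of the factors and the total variation. -/
lemma lintegral_map_le_add_of_le_mul {Ω : Type*} [MeasurableSpace Ω] {P : Measure Ω}
    [IsFiniteMeasure P] {Z : Ω → E} (hZ : Measurable Z) (Q : Measure E) [IsFiniteMeasure Q]
    {Φ : E → ℝ≥0∞} (hΦ : Measurable Φ) {f g : Ω → ℝ≥0∞} (hf : AEMeasurable f P)
    (hg : AEMeasurable g P) (hfg : ∀ᵐ ω ∂P, Φ (Z ω) ≤ f ω * g ω) {β : ℝ≥0∞}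
    (hβ : ∀ s, MeasurableSet s → P.map Z s - Q s ≤ β)
    {p q : ℝ} (hp : 0 < p) (hq : 0 < q) (hpq : 1 / p + 1 / q ≤ 1) :
    ∫⁻ x, Φ x ∂(P.map Z) ≤ (∫⁻ ω, f ω ^ p ∂P) ^ (1 / p) * (∫⁻ ω, g ω ^ q ∂P) ^ (1 / q) *
      β ^ (1 - 1 / p - 1 / q) + ∫⁻ x, Φ x ∂Q := by
  obtain ⟨ρ, hρ, hJ, s, hs, hρs⟩ := exists_le_and_le_add (P.map Z) Q
  have : IsFiniteMeasure ρ := isFiniteMeasure_of_le _ hρ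
  have hac : ρ ≪ P.map Z := Measure.absolutelyContinuous_of_le hρ
  have hden : (P.map Z).withDensity (ρ.rnDeriv (P.map Z)) = ρ :=
    Measure.withDensity_rnDeriv_eq _ _ hac
  have hmeas : Measurable (ρ.rnDeriv (P.map Z)) := Measure.measurable_rnDeriv _ _
  have hone : ∀ᵐ ω ∂P, ρ.rnDeriv (P.map Z) (Z ω) ≤ 1 :=
    ae_of_ae_map hZ.aemeasurable (Measure.rnDeriv_le_one_of_le hρ)
  have hmass : ∫⁻ ω, ρ.rnDeriv (P.map Z) (Z ω) ∂P ≤ β := by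
    rw [← lintegral_map hmeas hZ, Measure.lintegral_rnDeriv hac, hρs]
    exact hβ s hs
  calc ∫⁻ x, Φ x ∂(P.map Z) ≤ ∫⁻ x, Φ x ∂(ρ + Q) := lintegral_mono' hJ le_rfl
    _ = ∫⁻ x, Φ x ∂ρ + ∫⁻ x, Φ x ∂Q := lintegral_add_measure _ _ _
    _ ≤ _ := by
      gcongr
      calc ∫⁻ x, Φ x ∂ρ = ∫⁻ ω, ρ.rnDeriv (P.map Z) (Z ω) * Φ (Z ω) ∂P := by
            conv_lhs => rw [← hden]
            rw [lintegral_withDensity_eq_lintegral_mul _ hmeas hΦ,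
              lintegral_map (hmeas.mul hΦ) hZ]
            rfl
        _ ≤ ∫⁻ ω, f ω * g ω * ρ.rnDeriv (P.map Z) (Z ω) ∂P := by
            refine lintegral_mono_ae ?_
            filter_upwards [hfg] with ω hω
            rw [mul_comm]
            gcongr
        _ ≤ _ := (lintegral_mul_mul_le_of_le_one hf hg (hmeas.comp hZ).aemeasurable hone
            hp hq hpq).trans
              (mul_le_mul' le_rfl (ENNReal.rpow_le_rpow hmass (by linarith)))

end TotalVariation

section LocalIntegral

variable {N X Y : Type*} [MeasurableSpace N] [MeasurableSpace X] [MeasurableSpace Y]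

/-- For a measurable family of measures `T`, the integral over `B` depends measurably on
parameters, once the parameters with `T x B = ∞` are discarded. -/
lemma exists_measurable_eq_setLIntegral {T : N → Measure X} (hT : Measurable T) {B : Set X}
    (hB : MeasurableSet B) {u : Y × X → ℝ≥0∞} (hu : Measurable u) :
    ∃ Φ : N × Y → ℝ≥0∞, Measurable Φ ∧
      ∀ x y, T x B ≠ ∞ → Φ (x, y) = ∫⁻ z in B, u (y, z) ∂(T x) := by
  have hTB : Measurable fun x => T x B := (Measure.measurable_coe hB).comp hT
  let K : ProbabilityTheory.Kernel N X :=
    { toFun := fun x => (T x B)⁻¹ • (T x).restrict B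
      measurable' := by
        refine Measure.measurable_of_measurable_coe _ fun s hs => ?_
        simp only [Measure.smul_apply, smul_eq_mul, Measure.restrict_apply hs]
        exact hTB.inv.mul ((Measure.measurable_coe (hs.inter hB)).comp hT) }
  have hKapply (x : N) : K x = (T x B)⁻¹ • (T x).restrict B := rfl
  have : ProbabilityTheory.IsFiniteKernel K := ⟨1, by simp, fun x => by
    simp [hKapply]⟩
  refine ⟨fun w => T w.1 B * ∫⁻ z, u (w.2, z) ∂(K.comap Prod.fst measurable_fst w),
    (hTB.comp measurable_fst).mul (Measurable.lintegral_kernel_prod_right'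
      (f := fun v : (N × Y) × X => u (v.1.2, v.2)) (by fun_prop)), fun x y hx => ?_⟩
  simp only [ProbabilityTheory.Kernel.comap_apply, hKapply, lintegral_smul_measure, smul_eq_mul]
  rcases eq_or_ne (T x B) 0 with h0 | h0
  · simp [h0, Measure.restrict_eq_zero.2 h0]
  · rw [← mul_assoc, ENNReal.mul_inv_cancel h0 hx, one_mul]

/-- An integral over `B` is at most the supremum over `B` times the mass of `B`. -/
lemma setLIntegral_le_mul_iSup (μ : Measure X) {B : Set X} (hB : MeasurableSet B) (u : X → ℝ≥0∞) :
    ∫⁻ z in B, u z ∂μ ≤ μ B * ⨆ z ∈ B, u z := by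
  calc ∫⁻ z in B, u z ∂μ ≤ ∫⁻ _ in B, (⨆ z ∈ B, u z) ∂μ :=
        setLIntegral_mono' hB fun z hz => le_iSup₂ (f := fun z _ => u z) z hz
    _ = _ := by rw [setLIntegral_const, mul_comm]

end LocalIntegral


/-- Lemma 2.1 of the paper: a bound on the integrated difference between the Palm
expectations (with respect to a localized subprocess `ζ = T ∘ ξ`) and the ordinary
expectations of a nonnegative statistic `F` of the restricted process, in terms of
moments and the β-mixing coefficient `β^ξ_{B+D, B+A}`.

Here the space `N` of counting measures is modelled by `Measure (Fin d → ℝ)` equipped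
with the σ-algebra generated by the evaluation maps (the Giry σ-algebra), a point process
is a measurable map `ξ : Ω → Measure (Fin d → ℝ)`, restriction `μ_C` is `μ.restrict C`,
`C_z = C + z`, and the Palm version `(ξ^{z,ζ})` is encoded by a Markov kernel `κ` whose
defining disintegration identity is hypothesis `hPalm`. -/
theorem stmt2 {d : ℕ} {Ω : Type*} [MeasurableSpace Ω] (P : Measure Ω) [IsProbabilityMeasure P]
    (ξ : Ω → Measure (Fin d → ℝ)) (hξ : Measurable ξ) (hξσ : ∀ ω, SigmaFinite (ξ ω))
    (B D : Set (Fin d → ℝ)) (hB : IsCompact B) (hD : IsCompact D)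
    (A : Set (Fin d → ℝ))
    (hA : Measurable (fun zμ : (Fin d → ℝ) × Measure (Fin d → ℝ) =>
        zμ.2.restrict ((fun a => a + zμ.1) '' A)))
    (T : Measure (Fin d → ℝ) → Measure (Fin d → ℝ)) (hT : Measurable T)
    (hloc : ∀ μ : Measure (Fin d → ℝ), (T μ).restrict B = (T (μ.restrict (B + D))).restrict B)
    (Iζ : Measure (Fin d → ℝ)) [IsLocallyFiniteMeasure Iζ]
    (hIζ : ∀ C : Set (Fin d → ℝ), MeasurableSet C → Iζ C = ∫⁻ ω, T (ξ ω) C ∂P)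
    (κ : ProbabilityTheory.Kernel (Fin d → ℝ) (Measure (Fin d → ℝ)))
    [ProbabilityTheory.IsMarkovKernel κ]
    (hPalm : ∀ f : (Fin d → ℝ) × Measure (Fin d → ℝ) → ℝ≥0∞, Measurable f →
        ∫⁻ ω, ∫⁻ z, f (z, ξ ω) ∂(T (ξ ω)) ∂P = ∫⁻ z, ∫⁻ μ, f (z, μ) ∂(κ z) ∂Iζ)
    (F : Measure (Fin d → ℝ) → ℝ≥0) (hF : Measurable F)
    (hFjm : Measurable (fun zω : (Fin d → ℝ) × Ω =>
        F ((ξ zω.2).restrict ((fun a => a + zω.1) '' A))))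
    (hFsup : Measurable (fun ω =>
        ⨆ z ∈ B, (F ((ξ ω).restrict ((fun a => a + z) '' A)) : ℝ≥0∞)))
    (p q : ℝ) (hp : 0 < p) (hq : 0 < q) (hpq : 1 / p + 1 / q ≤ 1) :
    (let Ia : ℝ≥0∞ :=
      ∫⁻ z in B, ∫⁻ μ, (F (μ.restrict ((fun a => a + z) '' A)) : ℝ≥0∞) ∂(κ z) ∂Iζ;
    let Ib : ℝ≥0∞ :=
      ∫⁻ z in B, ∫⁻ ω, (F ((ξ ω).restrict ((fun a => a + z) '' A)) : ℝ≥0∞) ∂P ∂Iζ;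
    let jointLaw : Measure (Measure (Fin d → ℝ) × Measure (Fin d → ℝ)) :=
      P.map (fun ω => ((ξ ω).restrict (B + D), (ξ ω).restrict (B + A)));
    let prodLaw : Measure (Measure (Fin d → ℝ) × Measure (Fin d → ℝ)) :=
      (P.map (fun ω => (ξ ω).restrict (B + D))).prod
        (P.map (fun ω => (ξ ω).restrict (B + A)));
    let βmix : ℝ≥0∞ :=
      ⨆ (C : Set (Measure (Fin d → ℝ) × Measure (Fin d → ℝ))) (_ : MeasurableSet C),
        (jointLaw C - prodLaw C) ⊔ (prodLaw C - jointLaw C);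
    (Ia - Ib) ⊔ (Ib - Ia) ≤
      4 * (∫⁻ ω, (T (ξ ω) B) ^ p ∂P) ^ (1 / p) *
        (∫⁻ ω, (⨆ z ∈ B, (F ((ξ ω).restrict ((fun a => a + z) '' A)) : ℝ≥0∞)) ^ q ∂P) ^
          (1 / q) *
        βmix ^ (1 - 1 / p - 1 / q)) := by
  intro Ia Ib jointLaw prodLaw βmix
  have hBm : MeasurableSet B := hB.measurableSet
  have hBA : MeasurableSet (B + A) := by
    have h := measurableSet_biUnion_of_measurable_restrict (X := Fin d → ℝ)
      (S := fun z => (fun a => a + z) '' A) hA B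
    convert h using 1
    ext x
    simp only [Set.mem_add, Set.mem_iUnion, Set.mem_image, exists_prop, add_comm]
  have hX : Measurable fun ω => (ξ ω).restrict (B + D) :=
    (measurable_measure_restrict (hB.add hD).measurableSet).comp hξ
  have hY : Measurable fun ω => (ξ ω).restrict (B + A) :=
    (measurable_measure_restrict hBA).comp hξ
  have hFA : Measurable fun w : Measure (Fin d → ℝ) × (Fin d → ℝ) =>
      (F (w.1.restrict ((fun a => a + w.2) '' A)) : ℝ≥0∞) :=
    (hF.comp (hA.comp measurable_swap)).coe_nnreal_ennreal
  have hTξ : Measurable fun ω => T (ξ ω) B := (Measure.measurable_coe hBm).comp (hT.comp hξ)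
  have hTX (ω : Ω) : (T ((ξ ω).restrict (B + D))).restrict B = (T (ξ ω)).restrict B :=
    (hloc (ξ ω)).symm
  have hTXB (ω : Ω) : T ((ξ ω).restrict (B + D)) B = T (ξ ω) B := by
    simpa using congrArg (fun μ : Measure (Fin d → ℝ) => μ Set.univ) (hTX ω)
  have hFY (ω : Ω) (z : Fin d → ℝ) (hz : z ∈ B) :
      ((ξ ω).restrict (B + A)).restrict ((fun a => a + z) '' A) =
        (ξ ω).restrict ((fun a => a + z) '' A) := by
    refine Measure.restrict_restrict_of_subset ?_
    rintro _ ⟨a, ha, rfl⟩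
    exact ⟨z, hz, a, ha, add_comm z a⟩
  have hfin : ∀ᵐ ω ∂P, T (ξ ω) B ≠ ∞ := by
    have h : ∫⁻ ω, T (ξ ω) B ∂P ≠ ∞ := by
      rw [← hIζ B hBm]
      exact hB.measure_lt_top.ne
    filter_upwards [ae_lt_top hTξ h] with ω hω using hω.ne
  obtain ⟨Φ, hΦm, hΦ⟩ := exists_measurable_eq_setLIntegral hT hBm hFA
  have hΦXY (ω ω' : Ω) (hω : T (ξ ω) B ≠ ∞) :
      Φ ((ξ ω).restrict (B + D), (ξ ω').restrict (B + A)) =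
        ∫⁻ z in B, (F ((ξ ω').restrict ((fun a => a + z) '' A)) : ℝ≥0∞) ∂(T (ξ ω)) := by
    rw [hΦ _ _ (by rwa [hTXB]), hTX]
    refine setLIntegral_congr_fun hBm fun z hz => ?_
    simp only [hFY ω' z hz]
  have hbound (ω ω' : Ω) (hω : T (ξ ω) B ≠ ∞) :
      Φ ((ξ ω).restrict (B + D), (ξ ω').restrict (B + A)) ≤ T (ξ ω) B *
        ⨆ z ∈ B, (F ((ξ ω').restrict ((fun a => a + z) '' A)) : ℝ≥0∞) := by
    rw [hΦXY ω ω' hω]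
    exact setLIntegral_le_mul_iSup _ hBm _
  have hprod : prodLaw = (P.prod P).map
      (Prod.map (fun ω => (ξ ω).restrict (B + D)) fun ω => (ξ ω).restrict (B + A)) :=
    Measure.map_prod_map _ _ hX hY
  have hXY := hX.prodMap hY
  have : IsProbabilityMeasure jointLaw :=
    Measure.isProbabilityMeasure_map (hX.prodMk hY).aemeasurable
  have : IsProbabilityMeasure prodLaw := by
    rw [hprod]
    exact Measure.isProbabilityMeasure_map hXY.aemeasurable
  have hIa : Ia = ∫⁻ w, Φ w ∂jointLaw := by
    have h := hPalm (fun w => B.indicator 1 w.1 * F (w.2.restrict ((fun a => a + w.1) '' A)))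
      (((measurable_one.indicator hBm).comp measurable_fst).mul
        (hFA.comp measurable_swap))
    rw [lintegral_map hΦm (hX.prodMk hY)]
    calc Ia = ∫⁻ z, ∫⁻ μ, B.indicator 1 z * (F (μ.restrict ((fun a => a + z) '' A)) : ℝ≥0∞)
          ∂(κ z) ∂Iζ := by
          simp only [Ia]
          rw [← lintegral_indicator hBm]
          refine lintegral_congr fun z => ?_
          by_cases hz : z ∈ B <;> simp [hz]
      _ = _ := h.symm
      _ = _ := by
          refine lintegral_congr_ae ?_
          filter_upwards [hfin] with ω hω
          rw [hΦXY ω ω hω, ← lintegral_indicator hBm]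
          refine lintegral_congr fun z => ?_
          by_cases hz : z ∈ B <;> simp [hz]
  have hk : Measurable fun z : Fin d → ℝ =>
      ∫⁻ ω, (F ((ξ ω).restrict ((fun a => a + z) '' A)) : ℝ≥0∞) ∂P :=
    hFjm.coe_nnreal_ennreal.lintegral_prod_right'
  have hIb : Ib = ∫⁻ w, Φ w ∂prodLaw := by
    have h := hPalm (fun w => B.indicator
      (fun z => ∫⁻ ω, (F ((ξ ω).restrict ((fun a => a + z) '' A)) : ℝ≥0∞) ∂P) w.1)
      ((hk.indicator hBm).comp measurable_fst)
    simp only [lintegral_const, measure_univ, mul_one] at h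
    rw [hprod, lintegral_map hΦm hXY,
      lintegral_prod (fun w => Φ (Prod.map _ _ w)) (hΦm.comp hXY).aemeasurable]
    calc Ib = _ := by
          simp only [Ib]
          rw [← lintegral_indicator hBm]
      _ = _ := h.symm
      _ = _ := by
          refine lintegral_congr_ae ?_
          filter_upwards [hfin] with ω hω
          have : IsFiniteMeasure ((T (ξ ω)).restrict B) := ⟨by simpa using hω.lt_top⟩
          rw [lintegral_indicator hBm,
            lintegral_lintegral_swap hFjm.coe_nnreal_ennreal.aemeasurable]
          exact lintegral_congr fun ω' => (hΦXY ω ω' hω).symm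
  have hβ (s : Set (Measure (Fin d → ℝ) × Measure (Fin d → ℝ))) (hs : MeasurableSet s) :
      (jointLaw s - prodLaw s) ⊔ (prodLaw s - jointLaw s) ≤ βmix :=
    le_iSup₂ (f := fun C (_ : MeasurableSet C) =>
      (jointLaw C - prodLaw C) ⊔ (prodLaw C - jointLaw C)) s hs
  have hab : Ia ≤ (∫⁻ ω, (T (ξ ω) B) ^ p ∂P) ^ (1 / p) *
      (∫⁻ ω, (⨆ z ∈ B, (F ((ξ ω).restrict ((fun a => a + z) '' A)) : ℝ≥0∞)) ^ q ∂P) ^ (1 / q) *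
        βmix ^ (1 - 1 / p - 1 / q) + Ib := by
    rw [hIa, hIb]
    exact lintegral_map_le_add_of_le_mul (hX.prodMk hY) prodLaw hΦm hTξ.aemeasurable
      hFsup.aemeasurable (hfin.mono fun ω hω => hbound ω ω hω)
      (fun s hs => le_sup_left.trans (hβ s hs)) hp hq hpq
  have hba : Ib ≤ (∫⁻ ω, (T (ξ ω) B) ^ p ∂P) ^ (1 / p) *
      (∫⁻ ω, (⨆ z ∈ B, (F ((ξ ω).restrict ((fun a => a + z) '' A)) : ℝ≥0∞)) ^ q ∂P) ^ (1 / q) *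
        βmix ^ (1 - 1 / p - 1 / q) + Ia := by
    have h := lintegral_map_le_add_of_le_mul hXY jointLaw hΦm
      (hTξ.comp measurable_fst).aemeasurable (hFsup.comp measurable_snd).aemeasurable
      ((Measure.quasiMeasurePreserving_fst.ae hfin).mono fun ω hω => hbound ω.1 ω.2 hω)
      (fun s hs => le_sup_right.trans (hprod ▸ hβ s hs)) hp hq hpq
    simp only [Function.comp_apply] at h
    rwa [measurePreserving_fst.lintegral_comp (hTξ.pow_const p),
      measurePreserving_snd.lintegral_comp (hFsup.pow_const q), ← hprod, ← hIa, ← hIb] at h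
  refine (sup_le (tsub_le_iff_right.2 hab) (tsub_le_iff_right.2 hba)).trans ?_
  rw [mul_assoc, mul_assoc, mul_assoc]
  exact le_mul_of_one_le_left (zero_le) (by norm_num)
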